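/- For every n ∈ J^c, φ'(n) = (2πi/N) · exp( −2πinP/N + β(n) ), where β(n) = Σ_{k∈J^c} α(n−k) and φ' is the derivative of φ on ℝ. (This is the second formula of the paper's Theorem 2.) -/

import Mathlib

open Finset

/-- A root of unity `exp (-(2πim/N))` with `N ∤ m` differs from `1`. -/
lemma one_sub_exp_ne_zero_of_not_dvd {N : ℕ} (hN : N ≠ 0) {m : ℤ} (hm : ¬ (N : ℤ) ∣ m) :
    1 - Complex.exp (-(2 * Real.pi * Complex.I * m / N)) ≠ 0 := by
  intro h
  obtain ⟨j, hj⟩ := Complex.exp_eq_one_iff.1 (sub_eq_zero.1 h).symm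
  have hNC : (N : ℂ) ≠ 0 := Nat.cast_ne_zero.2 hN
  have hmj : (m : ℂ) = N * (-j) := by
    apply mul_left_cancel₀ Complex.two_pi_I_ne_zero
    field_simp at hj
    linear_combination (-2 * Real.pi * Complex.I : ℂ) * hj
  exact hm ⟨-j, by exact_mod_cast hmj⟩

/-- The derivative of a product at a zero of its first factor. -/
lemma HasDerivAt.mul_of_left_eq_zero {f g : ℝ → ℂ} {f' : ℂ} {x : ℝ} (hf : HasDerivAt f f' x)
    (hg : DifferentiableAt ℝ g x) (hx : f x = 0) :
    HasDerivAt (fun t => f t * g t) (f' * g x) x := by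
  simpa [hx] using hf.fun_mul hg.hasDerivAt

lemma not_natCast_dvd_sub_of_lt {N n k : ℕ} (hn : n < N) (hk : k < N) (hkn : k ≠ n) :
    ¬ (N : ℤ) ∣ (n : ℤ) - k := by
  intro h
  have := Int.eq_zero_of_abs_lt_dvd h (by rw [abs_lt]; omega)
  omega

/-- Second formula of the paper's Theorem 2: for `n ∈ Jᶜ`,
`φ'(n) = (2πi/N) · exp(−2πinP/N + β(n))` where `β(n) = Σ_{k∈Jᶜ} α(n−k)`. -/
theorem deriv_erasure_values_via_convolution
    (N P : ℕ) (hP : 0 < P) (hPN : P < N)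
    (J : Finset ℕ) (hJsub : J ⊆ Finset.range N) (hJcard : J.card = P)
    (φ : ℝ → ℂ)
    (hφ : ∀ t : ℝ, φ t =
      ∏ k ∈ Finset.range N \ J,
        (Complex.exp (2 * Real.pi * Complex.I * t / N) -
          Complex.exp (2 * Real.pi * Complex.I * k / N)))
    (α : ℤ → ℂ)
    (hα : ∀ m : ℤ, α m =
      if (N : ℤ) ∣ m then 0
      else Complex.log (1 - Complex.exp (-(2 * Real.pi * Complex.I * m / N))))
    (n : ℕ) (hn : n ∈ Finset.range N \ J) :
    deriv φ n = (2 * Real.pi * Complex.I / N) *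
      Complex.exp (-(2 * Real.pi * Complex.I * n * P / N) +
        ∑ k ∈ Finset.range N \ J, α ((n : ℤ) - k)) := by
  have hN : N ≠ 0 := by omega
  have hNC : (N : ℂ) ≠ 0 := Nat.cast_ne_zero.2 hN
  set S := Finset.range N \ J with hS
  have hcard : S.card + P = N := by
    rw [hS, ← hJcard, Finset.card_sdiff_add_card_eq_card hJsub, Finset.card_range]
  have hlt : ∀ k ∈ S, k < N := fun k hk => Finset.mem_range.1 (Finset.mem_sdiff.1 hk).1
  have hexp : HasDerivAt (fun t : ℝ => Complex.exp (2 * Real.pi * Complex.I * t / N))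
      (Complex.exp (2 * Real.pi * Complex.I * n / N) * (2 * Real.pi * Complex.I / N)) (n : ℝ) := by
    have h := (((Complex.ofRealCLM.hasDerivAt (x := (n : ℝ))).const_mul
      (2 * Real.pi * Complex.I : ℂ)).div_const (N : ℂ)).cexp
    simpa using h
  have hfactor : ∀ k ∈ S.erase n,
      Complex.exp (2 * Real.pi * Complex.I * n / N) - Complex.exp (2 * Real.pi * Complex.I * k / N) =
        Complex.exp (2 * Real.pi * Complex.I * n / N) * Complex.exp (α ((n : ℤ) - k)) := by
    intro k hk
    obtain ⟨hkn, hkS⟩ := Finset.mem_erase.1 hk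
    have hdvd := not_natCast_dvd_sub_of_lt (hlt n hn) (hlt k hkS) hkn
    rw [hα, if_neg hdvd, Complex.exp_log (one_sub_exp_ne_zero_of_not_dvd hN hdvd), mul_sub,
      mul_one, ← Complex.exp_add]
    congr 2
    push_cast
    ring
  have hsum : ∑ k ∈ S.erase n, α ((n : ℤ) - k) = ∑ k ∈ S, α ((n : ℤ) - k) :=
    Finset.sum_erase _ (by simp [hα])
  have hprod : ∏ k ∈ S.erase n, (Complex.exp (2 * Real.pi * Complex.I * n / N) -
        Complex.exp (2 * Real.pi * Complex.I * k / N)) =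
      Complex.exp (2 * Real.pi * Complex.I * n / N) ^ (S.erase n).card *
        Complex.exp (∑ k ∈ S, α ((n : ℤ) - k)) := by
    rw [Finset.prod_congr rfl hfactor, Finset.prod_mul_distrib, Finset.prod_const,
      ← Complex.exp_sum, hsum]
  have hpow : Complex.exp (2 * Real.pi * Complex.I * n / N) ^ S.card =
      Complex.exp (-(2 * Real.pi * Complex.I * n * P / N)) := by
    have hcardC : (S.card : ℂ) = N - P := by
      rw [eq_sub_iff_add_eq]
      exact_mod_cast hcard
    rw [← Complex.exp_nat_mul, Complex.exp_eq_exp_iff_exists_int]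
    refine ⟨n, ?_⟩
    rw [hcardC]
    push_cast
    field_simp
    ring
  have hsplit : φ = fun t : ℝ =>
      (Complex.exp (2 * Real.pi * Complex.I * t / N) -
        Complex.exp (2 * Real.pi * Complex.I * n / N)) *
      ∏ k ∈ S.erase n, (Complex.exp (2 * Real.pi * Complex.I * t / N) -
        Complex.exp (2 * Real.pi * Complex.I * k / N)) := by
    funext t
    rw [hφ, ← Finset.mul_prod_erase S _ hn]
  have hderiv := (hexp.sub_const (Complex.exp (2 * Real.pi * Complex.I * n / N))).mul_of_left_eq_zero
    (g := fun t : ℝ => ∏ k ∈ S.erase n, (Complex.exp (2 * Real.pi * Complex.I * t / N) -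
      Complex.exp (2 * Real.pi * Complex.I * k / N)))
    (DifferentiableAt.fun_finsetProd fun k _ => hexp.differentiableAt.sub_const _) (by simp)
  rw [hsplit, hderiv.deriv, Complex.ofReal_natCast, hprod, Complex.exp_add, ← hpow,
    ← Finset.card_erase_add_one hn]
  ring
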